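/- Let Δ ≥ 0, let W ∈ ℤ^{h×n} have all entries of absolute value at most Δ, and let M ∈ ℤ^{m×n} have every column of 1-norm at most 2. Let A ∈ ℤ^{(h+m)×n} be the matrix obtained by stacking W on top of M, and let g be a Graver basis element of A. Then g can be written as g = Σ_{k=1}^ℓ g_k with ℓ ≤ (2Δh(2m+1)+1)^h, where each g_k ∈ ℤ^n is nonzero, satisfies M·g_k = 0, is conformal to g (g_k ⊑ g), and has ‖g_k‖₁ ≤ 2m+1 and ‖g_k‖_∞ ≤ 2. -/

import Mathlib

open Matrix BigOperators

/-- A Graver basis element of an integer matrix `A`: a nonzero integer kernel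
vector `g` such that no other nonzero integer kernel vector is conformal to `g`. -/
def IsGraverElement {s t : Type*} [Fintype s] [Fintype t]
    (A : Matrix s t ℤ) (g : t → ℤ) : Prop :=
  g ≠ 0 ∧ A.mulVec g = 0 ∧
  ∀ g' : t → ℤ, g' ≠ 0 → g' ≠ g → A.mulVec g' = 0 →
    ¬(∀ j, |g' j| ≤ |g j| ∧ 0 ≤ g' j * g j)

/-- feasible weights -/
def SFeas {d ℓ : ℕ} (w : Fin ℓ → Fin d → ℤ) (S : Finset (Fin ℓ)) (c : ℚ) (l : Fin ℓ → ℚ) : Prop :=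
  (∀ k ∈ S, 0 ≤ l k ∧ l k ≤ 1) ∧ (∀ i, ∑ k ∈ S, l k * (w k i : ℚ) = 0) ∧ ∑ k ∈ S, l k = c

theorem rel_exists {d ℓ : ℕ} (w : Fin ℓ → Fin d → ℤ) (F : Finset (Fin ℓ)) (hF : d + 1 < F.card) :
    ∃ μ : Fin ℓ → ℚ, (∀ i, ∑ k ∈ F, μ k * (w k i : ℚ) = 0) ∧ ∑ k ∈ F, μ k = 0 ∧ ∃ k ∈ F, μ k ≠ 0 := by
  let v : F → (Option (Fin d) → ℚ) := fun k o => match o with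
    | none => 1
    | some i => (w k i : ℚ)
  have hnl : ¬ LinearIndependent ℚ v := by
    intro hli
    have := hli.fintype_card_le_finrank
    simp at this
    omega
  rw [Fintype.not_linearIndependent_iff] at hnl
  obtain ⟨f, hf, k0, hk0⟩ := hnl
  refine ⟨fun k => if h : k ∈ F then f ⟨k, h⟩ else 0, ?_, ?_, k0, k0.2, by simpa using hk0⟩
  · intro i
    have := congrFun hf (some i)
    rw [← Finset.sum_coe_sort]
    simpa [v, Finset.sum_apply] using this
  · have := congrFun hf none
    rw [← Finset.sum_coe_sort]
    simpa [v, Finset.sum_apply] using this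

theorem feas_zero {d ℓ : ℕ} (w : Fin ℓ → Fin d → ℤ) (S : Finset (Fin ℓ)) (hS : d + 1 ≤ S.card) :
    ∀ (N : ℕ) (l : Fin ℓ → ℚ), (S.filter (fun k => l k < 1)).card ≤ N →
      SFeas w S ((S.card : ℚ) - 1 - d) l →
      ∃ l', SFeas w S ((S.card : ℚ) - 1 - d) l' ∧ ∃ a ∈ S, l' a = 0 := by
  intro N
  induction N with
  | zero =>
    intro l hN hl
    exfalso
    have h1 : ∀ k ∈ S, l k = 1 := by
      intro k hk
      have : S.filter (fun k => l k < 1) = ∅ := by simpa using hN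
      have h2 := Finset.filter_eq_empty_iff.1 this hk
      exact le_antisymm (hl.1 k hk).2 (not_lt.1 h2)
    have := hl.2.2
    rw [Finset.sum_congr rfl h1] at this
    simp at this
    have : (0:ℚ) ≤ d := by positivity
    linarith
  | succ N ih =>
    intro l hN hl
    by_cases hz : ∃ a ∈ S, l a = 0
    · exact ⟨l, hl, hz⟩
    push Not at hz
    have hpos : ∀ k ∈ S, 0 < l k := fun k hk => lt_of_le_of_ne (hl.1 k hk).1 (Ne.symm (hz k hk))
    set F := S.filter (fun k => l k < 1) with hFdef
    have hFS : F ⊆ S := Finset.filter_subset _ _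
    have hF1 : ∀ k ∈ S, k ∉ F → l k = 1 := by
      intro k hk hkF
      have : ¬ l k < 1 := fun h => hkF (Finset.mem_filter.2 ⟨hk, h⟩)
      exact le_antisymm (hl.1 k hk).2 (not_lt.1 this)
    have hbig : d + 1 < F.card := by
      by_contra hcon
      push Not at hcon
      have hsum := hl.2.2
      rw [← Finset.sum_sdiff hFS] at hsum
      have e1 : ∑ k ∈ S \ F, l k = ((S \ F).card : ℚ) := by
        rw [Finset.sum_congr rfl (fun k hk => hF1 k (Finset.mem_sdiff.1 hk).1 (Finset.mem_sdiff.1 hk).2)]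
        simp
      have e2 : ((S \ F).card : ℚ) + F.card = S.card := by
        exact_mod_cast Finset.card_sdiff_add_card_eq_card hFS
      have e3 : (F.card : ℚ) ≤ d + 1 := by exact_mod_cast hcon
      rcases F.eq_empty_or_nonempty with h0 | h0
      · rw [e1, h0] at hsum
        rw [h0] at e2
        simp at hsum e2
        have : (0:ℚ) ≤ d := by positivity
        linarith
      · have : 0 < ∑ k ∈ F, l k := Finset.sum_pos (fun k hk => hpos k (hFS hk)) h0
        linarith
    obtain ⟨μ, hμ1, hμ2, k0, hk0, hk0'⟩ := rel_exists w F hbig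
    let τ : Fin ℓ → ℚ := fun k => if 0 < μ k then (1 - l k) / μ k else l k / (- μ k)
    obtain ⟨a, ha, hamin⟩ := Finset.exists_min_image (F.filter (fun k => μ k ≠ 0)) τ
      ⟨k0, by simp [hk0, hk0']⟩
    obtain ⟨haF, haμ⟩ := Finset.mem_filter.1 ha
    have hFl : ∀ k ∈ F, 0 < l k ∧ l k < 1 := fun k hk => ⟨hpos k (hFS hk), (Finset.mem_filter.1 hk).2⟩
    have hτ0 : 0 ≤ τ a := by
      have := hFl a haF
      simp only [τ]
      split_ifs with h
      · exact div_nonneg (by linarith) h.le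
      · exact div_nonneg this.1.le (by linarith)
    let l' : Fin ℓ → ℚ := fun k => if k ∈ F then l k + τ a * μ k else l k
    have hs : ∀ f : Fin ℓ → ℚ, ∑ k ∈ S, l' k * f k = ∑ k ∈ S, l k * f k + τ a * ∑ k ∈ F, μ k * f k := by
      intro f
      rw [← Finset.sum_sdiff hFS, ← Finset.sum_sdiff hFS (f := fun k => l k * f k), add_assoc, Finset.mul_sum,
        ← Finset.sum_add_distrib]
      congr 1
      · apply Finset.sum_congr rfl
        intro k hk
        simp [l', (Finset.mem_sdiff.1 hk).2]
      · apply Finset.sum_congr rfl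
        intro k hk
        simp only [l', hk, if_true]
        ring
    have hbd : ∀ k ∈ F, 0 ≤ l k + τ a * μ k ∧ l k + τ a * μ k ≤ 1 := by
      intro k hk
      have h1 := hFl k hk
      rcases lt_trichotomy (μ k) 0 with h | h | h
      · have h2 := hamin k (Finset.mem_filter.2 ⟨hk, h.ne⟩)
        have h3 : τ k = l k / (- μ k) := by simp [τ, not_lt.2 h.le]
        rw [h3, le_div_iff₀ (by linarith)] at h2
        constructor
        · linarith
        · have := mul_nonneg hτ0 (by linarith : 0 ≤ - μ k)
          linarith
      · rw [h]; simp; exact ⟨h1.1.le, h1.2.le⟩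
      · have h2 := hamin k (Finset.mem_filter.2 ⟨hk, h.ne'⟩)
        have h3 : τ k = (1 - l k) / μ k := by simp [τ, h]
        rw [h3, le_div_iff₀ h] at h2
        constructor
        · have := mul_nonneg hτ0 h.le
          linarith
        · linarith
    have hl' : SFeas w S ((S.card : ℚ) - 1 - d) l' := by
      refine ⟨?_, ?_, ?_⟩
      · intro k hk
        by_cases hkF : k ∈ F
        · simpa [l', hkF] using hbd k hkF
        · simpa [l', hkF] using hl.1 k hk
      · intro i
        rw [hs, hl.2.1, hμ1]; simp
      · have := hs (fun _ => 1)
        simp only [mul_one] at this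
        rw [this, hl.2.2, hμ2]; simp
    by_cases hsgn : 0 < μ a
    · apply ih l' _ hl'
      have hsub : S.filter (fun k => l' k < 1) ⊆ F.erase a := by
        intro k hk
        obtain ⟨hkS, hk1⟩ := Finset.mem_filter.1 hk
        have hkF : k ∈ F := by
          by_contra hkF
          simp only [l', hkF, if_false] at hk1
          exact hkF (Finset.mem_filter.2 ⟨hkS, hk1⟩)
        refine Finset.mem_erase.2 ⟨?_, hkF⟩
        rintro rfl
        have h3 : τ k = (1 - l k) / μ k := by simp [τ, hsgn]
        simp only [l', hkF, if_true, h3] at hk1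
        rw [div_mul_cancel₀ _ hsgn.ne'] at hk1
        linarith
      have := Finset.card_le_card hsub
      rw [Finset.card_erase_of_mem haF] at this
      omega
    · refine ⟨l', hl', a, hFS haF, ?_⟩
      have h3 : τ a = l a / (- μ a) := by simp [τ, hsgn]
      simp only [l', haF, if_true, h3]
      field_simp
      ring

/-- good subsets in the Steinitz argument -/
def SGood {d ℓ : ℕ} (w : Fin ℓ → Fin d → ℤ) (S : Finset (Fin ℓ)) : Prop :=
  S.card ≤ d ∨ (d ≤ S.card ∧ ∃ l, SFeas w S ((S.card : ℚ) - d) l)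

theorem good_step {d ℓ : ℕ} (w : Fin ℓ → Fin d → ℤ) (S : Finset (Fin ℓ)) (hS : SGood w S)
    (hne : S.Nonempty) : ∃ a ∈ S, SGood w (S.erase a) := by
  by_cases hc : S.card ≤ d
  · obtain ⟨a, ha⟩ := hne
    exact ⟨a, ha, Or.inl ((Finset.card_le_card (Finset.erase_subset _ _)).trans hc)⟩
  rcases hS with h | ⟨_, l, hl⟩
  · exact absurd h hc
  push Not at hc
  have hcq : (d : ℚ) + 1 ≤ S.card := by exact_mod_cast hc
  have hp : (0:ℚ) < (S.card : ℚ) - d := by linarith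
  set r : ℚ := ((S.card : ℚ) - 1 - d) / ((S.card : ℚ) - d) with hr
  have hr0 : 0 ≤ r := div_nonneg (by linarith) hp.le
  have hr1 : r ≤ 1 := by rw [hr, div_le_one hp]; linarith
  have hf : SFeas w S ((S.card : ℚ) - 1 - d) (fun k => r * l k) := by
    refine ⟨fun k hk => ⟨mul_nonneg hr0 (hl.1 k hk).1, ?_⟩, fun i => ?_, ?_⟩
    · exact mul_le_one₀ hr1 (hl.1 k hk).1 (hl.1 k hk).2
    · simp only [mul_assoc]
      rw [← Finset.mul_sum, hl.2.1, mul_zero]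
    · rw [← Finset.mul_sum, hl.2.2, hr, div_mul_cancel₀ _ hp.ne']
  obtain ⟨l', hl', a, ha, ha0⟩ := feas_zero w S hc _ _ le_rfl hf
  refine ⟨a, ha, Or.inr ⟨by rw [Finset.card_erase_of_mem ha]; omega, l', ?_, ?_, ?_⟩⟩
  · exact fun k hk => hl'.1 k (Finset.mem_of_mem_erase hk)
  · intro i
    rw [Finset.sum_erase _ (by simp [ha0])]
    exact hl'.2.1 i
  · rw [Finset.sum_erase _ ha0, hl'.2.2, Finset.card_erase_of_mem ha, Nat.cast_sub (by omega)]
    simp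

theorem good_bound {d ℓ : ℕ} (w : Fin ℓ → Fin d → ℤ) (B : ℤ) (hB0 : 0 ≤ B) (hB : ∀ k i, |w k i| ≤ B)
    (S : Finset (Fin ℓ)) (hS : SGood w S) (i : Fin d) : |∑ k ∈ S, w k i| ≤ d * B := by
  rcases hS with h | ⟨_, l, hl⟩
  · calc |∑ k ∈ S, w k i| ≤ ∑ k ∈ S, |w k i| := Finset.abs_sum_le_sum_abs _ _
      _ ≤ ∑ k ∈ S, B := Finset.sum_le_sum (fun k _ => hB k i)
      _ = S.card * B := by simp
      _ ≤ d * B := by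
        apply mul_le_mul_of_nonneg_right _ hB0
        exact_mod_cast h
  · have : |∑ k ∈ S, (w k i : ℚ)| ≤ d * B := by
      have e : ∑ k ∈ S, (w k i : ℚ) = ∑ k ∈ S, (1 - l k) * (w k i : ℚ) := by
        simp only [sub_mul, Finset.sum_sub_distrib, hl.2.1, one_mul, sub_zero]
      rw [e]
      calc |∑ k ∈ S, (1 - l k) * (w k i : ℚ)| ≤ ∑ k ∈ S, |(1 - l k) * (w k i : ℚ)| := Finset.abs_sum_le_sum_abs _ _
        _ ≤ ∑ k ∈ S, (1 - l k) * (B : ℚ) := by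
          apply Finset.sum_le_sum
          intro k hk
          have h1 := hl.1 k hk
          rw [abs_mul, abs_of_nonneg (by linarith)]
          apply mul_le_mul_of_nonneg_left _ (by linarith)
          exact_mod_cast hB k i
        _ = d * B := by
          rw [← Finset.sum_mul, Finset.sum_sub_distrib, hl.2.2]
          simp
    exact_mod_cast this

theorem good_chain {d ℓ : ℕ} (w : Fin ℓ → Fin d → ℤ) (B : ℤ) (hB0 : 0 ≤ B) (hB : ∀ k i, |w k i| ≤ B)
    (hirr : ∀ S : Finset (Fin ℓ), S.Nonempty → S ≠ Finset.univ → ∃ i, ∑ k ∈ S, w k i ≠ 0) :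
    ∀ (N : ℕ) (S : Finset (Fin ℓ)), S.card = N → SGood w S →
      ∃ T : Finset (Fin d → ℤ), T.card = N ∧
        ∀ p ∈ T, (∀ i, |p i| ≤ d * B) ∧ ∃ S' ⊆ S, S'.Nonempty ∧ ∀ i, p i = ∑ k ∈ S', w k i := by
  intro N
  induction N with
  | zero => intro S _ _; exact ⟨∅, by simp⟩
  | succ N ih =>
    intro S hc hS
    obtain ⟨a, ha, hg⟩ := good_step w S hS (Finset.card_pos.1 (by omega))
    obtain ⟨T, hT, hTp⟩ := ih (S.erase a) (by rw [Finset.card_erase_of_mem ha]; omega) hg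
    have hnot : (fun i => ∑ k ∈ S, w k i) ∉ T := by
      intro hmem
      obtain ⟨-, S', hS', hne, he⟩ := hTp _ hmem
      have hSS : S' ⊆ S := hS'.trans (Finset.erase_subset _ _)
      have haS' : a ∉ S' := fun h => by simpa using hS' h
      obtain ⟨i, hi⟩ := hirr (S \ S') ⟨a, Finset.mem_sdiff.2 ⟨ha, haS'⟩⟩ (by
        intro h
        obtain ⟨b, hb⟩ := hne
        have := Finset.mem_univ b
        rw [← h] at this
        exact (Finset.mem_sdiff.1 this).2 hb)
      have h1 := he i
      have h2 := Finset.sum_sdiff hSS (f := fun k => w k i)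
      apply hi
      linarith
    refine ⟨insert (fun i => ∑ k ∈ S, w k i) T, by rw [Finset.card_insert_of_notMem hnot, hT], ?_⟩
    intro p hp
    rcases Finset.mem_insert.1 hp with rfl | hp
    · exact ⟨fun i => good_bound w B hB0 hB S hS i, S, subset_rfl, ⟨a, ha⟩, fun _ => rfl⟩
    · obtain ⟨h1, S', h2, h3⟩ := hTp p hp
      exact ⟨h1, S', h2.trans (Finset.erase_subset _ _), h3⟩

theorem steinitz_count {d ℓ : ℕ} (w : Fin ℓ → Fin d → ℤ) (B : ℤ) (hB0 : 0 ≤ B) (hB : ∀ k i, |w k i| ≤ B)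
    (hsum : ∀ i, ∑ k, w k i = 0)
    (hirr : ∀ S : Finset (Fin ℓ), S.Nonempty → S ≠ Finset.univ → ∃ i, ∑ k ∈ S, w k i ≠ 0) :
    (ℓ : ℤ) ≤ (2 * (d * B) + 1) ^ d := by
  have hgood : SGood w Finset.univ := by
    by_cases h : ℓ ≤ d
    · left; simpa using h
    · right
      push Not at h
      have hq : (d : ℚ) < ℓ := by exact_mod_cast h
      have hd : (0:ℚ) ≤ d := by positivity
      refine ⟨by simpa using h.le, fun _ => ((ℓ : ℚ) - d) / ℓ, ?_, ?_, ?_⟩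
      · intro k _
        exact ⟨div_nonneg (by linarith) (by linarith), by rw [div_le_one (by linarith)]; linarith⟩
      · intro i
        rw [← Finset.mul_sum]
        have : ∑ k, (w k i : ℚ) = 0 := by exact_mod_cast hsum i
        rw [this, mul_zero]
      · have hl0 : (ℓ : ℚ) ≠ 0 := by linarith
        simp
        field_simp
  obtain ⟨T, hT, hTp⟩ := good_chain w B hB0 hB hirr ℓ Finset.univ (by simp) hgood
  have hsub : T ⊆ Fintype.piFinset (fun _ : Fin d => Finset.Icc (-(d * B)) (d * B)) := by
    intro p hp
    rw [Fintype.mem_piFinset]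
    intro i
    rw [Finset.mem_Icc]
    exact abs_le.1 ((hTp p hp).1 i)
  have := Finset.card_le_card hsub
  rw [hT, Fintype.card_piFinset] at this
  simp only [Int.card_Icc, Finset.prod_const, Finset.card_univ, Fintype.card_fin] at this
  have h0 : 0 ≤ d * B := by positivity
  calc (ℓ : ℤ) ≤ (((d * B + 1 - -(d * B)).toNat ^ d : ℕ) : ℤ) := by exact_mod_cast this
    _ = _ := by
      push_cast
      rw [Int.toNat_of_nonneg (by linarith)]
      congr 1
      ring

/-- signed unit vector -/
def uvec {m : ℕ} (q : Fin m × ℤˣ) : Fin m → ℤ := Pi.single q.1 (q.2 : ℤ)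

/-- linear combination of columns -/
def lcomb {m n : ℕ} (c : Fin n → Fin m → ℤ) (y : Fin n → ℤ) : Fin m → ℤ := fun i => ∑ j, y j * c j i

theorem lcomb_add {m n : ℕ} (c : Fin n → Fin m → ℤ) (x y : Fin n → ℤ) :
    lcomb c (x + y) = lcomb c x + lcomb c y := by
  funext i; simp [lcomb, add_mul, Finset.sum_add_distrib]

theorem lcomb_sub {m n : ℕ} (c : Fin n → Fin m → ℤ) (x y : Fin n → ℤ) :
    lcomb c (x - y) = lcomb c x - lcomb c y := by
  funext i; simp [lcomb, sub_mul, Finset.sum_sub_distrib]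

theorem lcomb_single {m n : ℕ} (c : Fin n → Fin m → ℤ) (j : Fin n) :
    lcomb c (Pi.single j 1) = c j := by
  funext i; simp [lcomb, Pi.single_apply]

theorem norm_step {m : ℕ} (v : Fin m → ℤ) (q : Fin m × ℤˣ) (h : v q.1 * q.2 < 0) :
    ∑ i, |(v + uvec q) i| = ∑ i, |v i| - 1 := by
  have : ∑ i, (|(v + uvec q) i| - |v i|) = -1 := by
    rw [Finset.sum_eq_single q.1]
    · rcases Int.units_eq_one_or q.2 with h2 | h2
      · simp [uvec, h2] at h ⊢
        rw [abs_of_neg h, abs_of_nonpos (by omega)]; ring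
      · simp [uvec, h2] at h ⊢
        rw [abs_of_pos h, abs_of_nonneg (by omega)]; ring
    · intro b _ hb
      simp [uvec, Pi.single_apply, hb]
    · simp
  rw [Finset.sum_sub_distrib] at this
  linarith

theorem norm_zero' {m : ℕ} (v : Fin m → ℤ) (h : ∑ i, |v i| = 0) : v = 0 := by
  funext i
  have := (Finset.sum_eq_zero_iff_of_nonneg (fun i _ => abs_nonneg (v i))).1 h i (Finset.mem_univ i)
  simpa using this

theorem exists_opp {m : ℕ} (v : Fin m → ℤ) (h : ∑ i, |v i| ≠ 0) : ∃ q : Fin m × ℤˣ, v q.1 * q.2 < 0 := by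
  have : ∃ b, v b ≠ 0 := by
    by_contra hc
    push Not at hc
    exact h (by simp [hc])
  obtain ⟨b, hb⟩ := this
  rcases lt_or_gt_of_ne hb with h | h
  · exact ⟨(b, 1), by simpa using h⟩
  · exact ⟨(b, -1), by simpa using h⟩

theorem uvec_neg {m : ℕ} (q : Fin m × ℤˣ) : uvec (q.1, -q.2) = - uvec q := by
  simp [uvec, Pi.single_neg]

theorem unit_of_norm_one {m : ℕ} (v : Fin m → ℤ) (h : ∑ i, |v i| = 1) : ∃ q, v = uvec q := by
  obtain ⟨q, hq⟩ := exists_opp v (by omega)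
  have h1 := norm_step v q hq
  have h2 := norm_zero' (v + uvec q) (by omega)
  exact ⟨(q.1, -q.2), by rw [uvec_neg]; exact eq_neg_of_add_eq_zero_left h2⟩

theorem card_opp_le {m : ℕ} (v : Fin m → ℤ) (Q : Finset (Fin m × ℤˣ)) :
    ((Q.filter (fun r => v r.1 * r.2 < 0)).card : ℤ) ≤ ∑ i, |v i| := by
  have h1 : (Q.filter (fun r => v r.1 * r.2 < 0)).card ≤ (Finset.univ.filter (fun i => v i ≠ 0)).card := by
    apply Finset.card_le_card_of_injOn (fun r => r.1)
    · intro r hr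
      have hr := (Finset.mem_filter.1 hr).2
      simp only [Finset.coe_filter, Finset.mem_univ, true_and, Set.mem_ofPred_eq]
      intro h0
      simp [h0] at hr
    · intro r hr s hs hrs
      have hr := (Finset.mem_filter.1 hr).2
      have hs := (Finset.mem_filter.1 hs).2
      simp only at hrs
      apply Prod.ext hrs
      rw [← hrs] at hs
      rcases Int.units_eq_one_or r.2 with h2 | h2 <;> rcases Int.units_eq_one_or s.2 with h3 | h3 <;>
        simp [h2, h3] at hr hs ⊢ <;> omega
  have h2 : ((Finset.univ.filter (fun i => v i ≠ 0)).card : ℤ) ≤ ∑ i, |v i| := by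
    rw [Finset.card_filter]
    push_cast
    apply Finset.sum_le_sum
    intro i _
    split_ifs with h
    · exact Int.one_le_abs h
    · positivity
  have : ((Q.filter (fun r => v r.1 * r.2 < 0)).card : ℤ) ≤ ((Finset.univ.filter (fun i => v i ≠ 0)).card : ℤ) := by
    exact_mod_cast h1
  linarith

/-- invariant of the trail construction -/
def TInv {m n : ℕ} (c : Fin n → Fin m → ℤ) (u : Fin m → ℤ) (g : Fin n → ℤ) (j0 : Fin n)
    (x : Fin n → ℤ) (Q : Finset (Fin m × ℤˣ)) : Prop :=
  (∀ j, 0 ≤ x j ∧ x j ≤ g j) ∧ x ≠ 0 ∧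
  (∀ r ∈ Q, ∃ y : Fin n → ℤ, (∀ j, 0 ≤ y j ∧ y j ≤ x j) ∧ y ≠ 0 ∧ y ≠ x ∧ lcomb c y = u + uvec r) ∧
  ∑ j, x j = (Q.card : ℤ) + 1 ∧
  ∀ j, x j ≤ (if j = j0 then 1 else 0) + ((Q.filter (fun r => c j r.1 * r.2 < 0)).card : ℤ)

theorem trail {m n : ℕ} (c : Fin n → Fin m → ℤ) (hM : ∀ j, ∑ i, |c j i| ≤ 2)
    (g : Fin n → ℤ) (hker : lcomb c g = 0)
    (hmin : ∀ y : Fin n → ℤ, (∀ j, 0 ≤ y j ∧ y j ≤ g j) → lcomb c y = 0 → y = 0 ∨ y = g)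
    (u : Fin m → ℤ) (hu : u = 0 ∨ ((∃ a, u = uvec a) ∧ ∀ j, 0 < g j → ∑ i, |c j i| = 2)) (j0 : Fin n) :
    ∀ (N : ℕ) (x : Fin n → ℤ) (q : Fin m × ℤˣ) (Q : Finset (Fin m × ℤˣ)),
      ∑ j, (g j - x j) ≤ N → TInv c u g j0 x Q → lcomb c x = u + uvec q →
      ∃ Q', TInv c u g j0 g Q' := by
  intro N
  induction N with
  | zero =>
    intro x q Q hN hI _
    have hx : x = g := by
      funext j
      have h0 : ∀ j ∈ Finset.univ, 0 ≤ g j - x j := fun j _ => by linarith [(hI.1 j).2]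
      have h1 : ∑ j, (g j - x j) = 0 := le_antisymm (by simpa using hN) (Finset.sum_nonneg h0)
      have := (Finset.sum_eq_zero_iff_of_nonneg h0).1 h1 j (Finset.mem_univ j)
      linarith
    subst hx
    exact ⟨Q, hI⟩
  | succ N ih =>
    intro x q Q hN hI hx
    by_cases hxg : x = g
    · subst hxg; exact ⟨Q, hI⟩
    obtain ⟨hb, hx0, hQ, hcard, hcnt⟩ := hI
    have huq : u + uvec q ≠ 0 := by
      intro h
      rcases hmin x hb (hx.trans h) with h | h
      · exact hx0 h
      · exact hxg h
    have hub : 0 ≤ u q.1 * q.2 := by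
      by_contra hneg
      push Not at hneg
      rcases hu with h | ⟨⟨a, ha⟩, -⟩
      · simp [h] at hneg
      · have h1 := norm_step u q hneg
        have h2 : ∑ i, |u i| = 1 := by
          rw [ha]
          simp only [uvec]
          rw [Finset.sum_eq_single a.1]
          · rcases Int.units_eq_one_or a.2 with h | h <;> simp [h]
          · intro b _ hb; simp [Pi.single_apply, hb]
          · simp
        exact huq (norm_zero' _ (by omega))
    obtain ⟨j, hj1, hj2⟩ : ∃ j, x j < g j ∧ c j q.1 * q.2 < 0 := by
      by_contra hcon
      push Not at hcon
      have h1 : 0 ≤ ∑ j, (g j - x j) * (c j q.1 * q.2) := by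
        apply Finset.sum_nonneg
        intro j _
        rcases (hb j).2.lt_or_eq with h | h
        · exact mul_nonneg (by linarith) (hcon j h)
        · simp [h]
      have h2 : ∑ j, (g j - x j) * (c j q.1 * q.2) = lcomb c (g - x) q.1 * q.2 := by
        simp only [lcomb, Finset.sum_mul, Pi.sub_apply, mul_assoc]
      rw [h2, lcomb_sub, hker, hx] at h1
      have h3 : (q.2 : ℤ) * q.2 = 1 := by
        rcases Int.units_eq_one_or q.2 with h | h <;> simp [h]
      simp [uvec] at h1
      nlinarith
    have hqQ : q ∉ Q := by
      intro hq
      obtain ⟨y, hy1, hy2, hy3, hy4⟩ := hQ q hq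
      have hk : lcomb c (x - y) = 0 := by rw [lcomb_sub, hx, hy4, sub_self]
      rcases hmin (x - y) (fun j => by
        have := hy1 j; have := hb j; simp only [Pi.sub_apply]; constructor <;> linarith) hk with h | h
      · exact hy3 (sub_eq_zero.1 h).symm
      · apply hy2
        funext j
        have h1 := congrFun h j
        have := hy1 j; have := hb j
        simp only [Pi.sub_apply, Pi.zero_apply] at *
        linarith
    let x' : Fin n → ℤ := x + Pi.single j 1
    have hx'j : ∀ k, x' k = x k + if k = j then 1 else 0 := by
      intro k; simp [x', Pi.single_apply]
    have hx' : lcomb c x' = u + (c j + uvec q) := by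
      simp only [x']
      rw [lcomb_add, lcomb_single, hx]; abel
    have hsum' : ∑ k, x' k = ∑ k, x k + 1 := by
      simp only [hx'j, Finset.sum_add_distrib]; simp
    have hxx' : ∀ k, x k ≤ x' k := by
      intro k; rw [hx'j]; split_ifs <;> linarith
    have hI' : TInv c u g j0 x' (insert q Q) := by
      refine ⟨?_, ?_, ?_, ?_, ?_⟩
      · intro k
        refine ⟨(hb k).1.trans (hxx' k), ?_⟩
        rw [hx'j]
        split_ifs with h
        · subst h; linarith
        · linarith [(hb k).2]
      · intro h
        apply hx0
        funext k
        have h1 := congrFun h k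
        have := hxx' k
        have := (hb k).1
        simp only [Pi.zero_apply] at *
        linarith
      · intro r hr
        have hne : ∀ y : Fin n → ℤ, (∀ k, y k ≤ x k) → y ≠ x' := by
          intro y hy h
          have h1 := hy j
          rw [h, hx'j] at h1
          simp at h1
        rcases Finset.mem_insert.1 hr with rfl | hr
        · exact ⟨x, fun k => ⟨(hb k).1, hxx' k⟩, hx0, hne x (fun _ => le_rfl), hx⟩
        · obtain ⟨y, hy1, hy2, hy3, hy4⟩ := hQ r hr
          exact ⟨y, fun k => ⟨(hy1 k).1, (hy1 k).2.trans (hxx' k)⟩, hy2, hne y (fun k => (hy1 k).2), hy4⟩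
      · rw [hsum', hcard, Finset.card_insert_of_notMem hqQ]; push_cast; ring
      · intro k
        have h1 := hcnt k
        rw [Finset.filter_insert]
        by_cases hk : k = j
        · subst hk
          rw [if_pos hj2, Finset.card_insert_of_notMem (fun h => hqQ (Finset.mem_filter.1 h).1), hx'j]
          push_cast
          simp only [if_true]
          linarith
        · rw [hx'j, if_neg hk]
          have h2 : ((Q.filter (fun r => c k r.1 * r.2 < 0)).card : ℤ) ≤
              ((if c k q.1 * q.2 < 0 then insert q (Q.filter (fun r => c k r.1 * r.2 < 0))
                else Q.filter (fun r => c k r.1 * r.2 < 0)).card : ℤ) := by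
            split_ifs
            · exact_mod_cast Finset.card_le_card (Finset.subset_insert _ _)
            · exact le_rfl
          linarith
    have hstep := norm_step (c j) q hj2
    have hMj := hM j
    have hnn : 0 ≤ ∑ i, |(c j + uvec q) i| := Finset.sum_nonneg (fun i _ => abs_nonneg _)
    by_cases h2 : ∑ i, |c j i| = 2
    · obtain ⟨q', hq'⟩ := unit_of_norm_one (c j + uvec q) (by omega)
      refine ih x' q' (insert q Q) ?_ hI' (by rw [hx', hq'])
      rw [Finset.sum_sub_distrib] at hN ⊢
      rw [hsum']
      push_cast at hN
      linarith
    · have hu0 : u = 0 := by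
        rcases hu with h | ⟨-, h⟩
        · exact h
        · exact absurd (h j (by linarith [(hb j).1])) h2
      have h3 := norm_zero' (c j + uvec q) (by omega)
      have h4 : x' = g := by
        rcases hmin x' hI'.1 (by rw [hx', hu0, h3, add_zero]) with h | h
        · exact absurd h hI'.2.1
        · exact h
      exact ⟨_, h4 ▸ hI'⟩

theorem graver_bound {m n : ℕ} (c : Fin n → Fin m → ℤ) (hM : ∀ j, ∑ i, |c j i| ≤ 2)
    (g : Fin n → ℤ) (hg : ∀ j, 0 ≤ g j) (hg0 : g ≠ 0) (hker : lcomb c g = 0)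
    (hmin : ∀ y : Fin n → ℤ, (∀ j, 0 ≤ y j ∧ y j ≤ g j) → lcomb c y = 0 → y = 0 ∨ y = g) :
    ∑ j, g j ≤ 2 * (m : ℤ) + 1 ∧ ∀ j, g j ≤ 2 := by
  have hsingle : ∀ j, 0 < g j → ∀ k, (0:ℤ) ≤ (Pi.single j 1 : Fin n → ℤ) k ∧ (Pi.single j 1 : Fin n → ℤ) k ≤ g k := by
    intro j hj k
    by_cases h : k = j
    · subst h; simp; omega
    · simp [h, hg k]
  have hsne : ∀ j, (Pi.single j 1 : Fin n → ℤ) ≠ 0 := by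
    intro j h
    have := congrFun h j
    simp at this
  by_cases hz : ∃ j, 0 < g j ∧ ∑ i, |c j i| = 0
  · obtain ⟨j, hj, hc⟩ := hz
    rcases hmin (Pi.single j 1) (hsingle j hj) (by rw [lcomb_single]; exact norm_zero' _ hc) with h | h
    · exact absurd h (hsne j)
    · rw [← h]
      constructor
      · simp
      · intro k
        by_cases h : k = j
        · subst h; simp
        · simp [h]
  push Not at hz
  have key : ∃ (j0 : Fin n) (u : Fin m → ℤ) (Q : Finset (Fin m × ℤˣ)), TInv c u g j0 g Q ∧
      ∑ i, |(c j0 - u) i| = 1 ∧ (u = 0 ∨ ∃ a, u = uvec a ∧ 0 < c j0 a.1 * a.2) := by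
    have start : ∀ (j0 : Fin n) (u : Fin m → ℤ), 0 < g j0 → ∑ i, |(c j0 - u) i| = 1 →
        (u = 0 ∨ ((∃ a, u = uvec a) ∧ ∀ j, 0 < g j → ∑ i, |c j i| = 2)) → ∃ Q, TInv c u g j0 g Q := by
      intro j0 u hj0 hn hu
      obtain ⟨q, hq⟩ := unit_of_norm_one _ hn
      refine trail c hM g hker hmin u hu j0 (∑ j, (g j - (Pi.single j0 1 : Fin n → ℤ) j)).toNat (Pi.single j0 1) q ∅
        (Int.self_le_toNat _) ⟨hsingle j0 hj0, hsne j0, by simp, by simp, ?_⟩ ?_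
      · intro j
        simp [Pi.single_apply]
      · rw [lcomb_single, ← hq]; abel
    by_cases h1 : ∃ j, 0 < g j ∧ ∑ i, |c j i| = 1
    · obtain ⟨j0, hj0, hc⟩ := h1
      obtain ⟨Q, hQ⟩ := start j0 0 hj0 (by simpa using hc) (Or.inl rfl)
      exact ⟨j0, 0, Q, hQ, by simpa using hc, Or.inl rfl⟩
    · push Not at h1
      have hall : ∀ j, 0 < g j → ∑ i, |c j i| = 2 := by
        intro j hj
        have := hz j hj; have := h1 j hj; have := hM j
        have : 0 ≤ ∑ i, |c j i| := Finset.sum_nonneg (fun i _ => abs_nonneg _)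
        omega
      obtain ⟨j0, hj0⟩ : ∃ j0, 0 < g j0 := by
        by_contra hcon
        push Not at hcon
        exact hg0 (funext fun j => le_antisymm (hcon j) (hg j))
      obtain ⟨q, hq⟩ := exists_opp (c j0) (by rw [hall j0 hj0]; norm_num)
      have hn : ∑ i, |(c j0 - uvec (q.1, -q.2)) i| = 1 := by
        rw [uvec_neg, sub_neg_eq_add, norm_step _ q hq, hall j0 hj0]; norm_num
      obtain ⟨Q, hQ⟩ := start j0 _ hj0 hn (Or.inr ⟨⟨_, rfl⟩, hall⟩)
      exact ⟨j0, _, Q, hQ, hn, Or.inr ⟨_, rfl, by simpa using hq⟩⟩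
  obtain ⟨j0, u, Q, ⟨-, -, hQ, hcard, hcnt⟩, hn, hu⟩ := key
  constructor
  · rw [hcard]
    have h1 : Q.card ≤ m * 2 := by
      have := Finset.card_le_univ Q
      simpa [Fintype.card_prod, Fintype.card_units_int] using this
    have : (Q.card : ℤ) ≤ m * 2 := by exact_mod_cast h1
    linarith
  · intro j
    have h1 := hcnt j
    by_cases hj : j = j0
    · subst hj
      rw [if_pos rfl] at h1
      have hsub : Q.filter (fun r => c j r.1 * r.2 < 0) ⊆ Q.filter (fun r => (c j - u) r.1 * r.2 < 0) := by
        intro r hr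
        obtain ⟨hrQ, hr⟩ := Finset.mem_filter.1 hr
        refine Finset.mem_filter.2 ⟨hrQ, ?_⟩
        rcases hu with h | ⟨a, ha, hpos⟩
        · simpa [h] using hr
        · have hne : r.1 ≠ a.1 := by
            intro he
            obtain ⟨y, hy1, hy2, hy3, hy4⟩ := hQ r hrQ
            have hra : r = (a.1, -a.2) := by
              refine Prod.ext he ?_
              rw [he] at hr
              rcases Int.units_eq_one_or r.2 with h2 | h2 <;> rcases Int.units_eq_one_or a.2 with h3 | h3 <;>
                simp [h2, h3] at hr hpos ⊢ <;> omega
            rw [hra, uvec_neg, ha, add_neg_cancel] at hy4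
            rcases hmin y hy1 hy4 with h | h
            · exact hy2 h
            · exact hy3 h
          have : u r.1 = 0 := by rw [ha]; simp [uvec, hne]
          simpa [this] using hr
      have h2 : ((Q.filter (fun r => c j r.1 * r.2 < 0)).card : ℤ) ≤
          ((Q.filter (fun r => (c j - u) r.1 * r.2 < 0)).card : ℤ) := by
        exact_mod_cast Finset.card_le_card hsub
      have h3 := card_opp_le (c j - u) Q
      linarith
    · rw [if_neg hj] at h1
      have := card_opp_le (c j) Q
      have := hM j
      linarith

theorem decomp {m n : ℕ} (c : Fin n → Fin m → ℤ) :
    ∀ (N : ℕ) (g : Fin n → ℤ), (∀ j, 0 ≤ g j) → ∑ j, g j ≤ N → lcomb c g = 0 →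
    ∃ (ℓ : ℕ) (gs : Fin ℓ → Fin n → ℤ), ∑ k, gs k = g ∧ ∀ k, (∀ j, 0 ≤ gs k j) ∧ gs k ≠ 0 ∧
      lcomb c (gs k) = 0 ∧
      ∀ y : Fin n → ℤ, (∀ j, 0 ≤ y j ∧ y j ≤ gs k j) → lcomb c y = 0 → y = 0 ∨ y = gs k := by
  have hpos : ∀ x : Fin n → ℤ, (∀ j, 0 ≤ x j) → x ≠ 0 → 0 < ∑ j, x j := by
    intro x hx hx0
    by_contra hcon
    have h0 : ∑ j, x j = 0 := le_antisymm (not_lt.1 hcon) (Finset.sum_nonneg (fun j _ => hx j))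
    exact hx0 (funext fun j =>
      (Finset.sum_eq_zero_iff_of_nonneg (fun j _ => hx j)).1 h0 j (Finset.mem_univ j))
  intro N
  induction N with
  | zero =>
    intro g hg hN hk
    have : g = 0 := by
      by_contra h
      have := hpos g hg h
      simp at hN
      omega
    exact ⟨0, Fin.elim0, by simp [this], fun k => k.elim0⟩
  | succ N ih =>
    intro g hg hN hk
    by_cases hg0 : g = 0
    · exact ⟨0, Fin.elim0, by simp [hg0], fun k => k.elim0⟩
    by_cases hmin : ∀ y : Fin n → ℤ, (∀ j, 0 ≤ y j ∧ y j ≤ g j) → lcomb c y = 0 → y = 0 ∨ y = g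
    · exact ⟨1, fun _ => g, by simp, fun _ => ⟨hg, hg0, hk, hmin⟩⟩
    push Not at hmin
    obtain ⟨y, hy, hyk, hy0, hyg⟩ := hmin
    have hz : ∀ j, 0 ≤ (g - y) j := fun j => by simpa using (hy j).2
    have hzpos := hpos (g - y) hz (sub_ne_zero.2 (Ne.symm hyg))
    have hypos := hpos y (fun j => (hy j).1) hy0
    simp only [Pi.sub_apply, Finset.sum_sub_distrib] at hzpos
    push_cast at hN
    obtain ⟨l1, g1, hs1, hp1⟩ := ih y (fun j => (hy j).1) (by linarith) hyk
    obtain ⟨l2, g2, hs2, hp2⟩ := ih (g - y) hz (by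
      simp only [Pi.sub_apply, Finset.sum_sub_distrib]; linarith) (by rw [lcomb_sub, hk, hyk, sub_zero])
    refine ⟨l1 + l2, Fin.append g1 g2, ?_, ?_⟩
    · rw [Fin.sum_univ_add]
      simp [hs1, hs2]
    · intro k
      refine Fin.addCases (fun k => ?_) (fun k => ?_) k
      · simpa using hp1 k
      · simpa using hp2 k

theorem statement13 {h m n : ℕ} (Δ : ℕ)
    (W : Matrix (Fin h) (Fin n) ℤ) (hW : ∀ i j, |W i j| ≤ (Δ : ℤ))
    (M : Matrix (Fin m) (Fin n) ℤ) (hM : ∀ j, (∑ i, |M i j|) ≤ 2)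
    (A : Matrix (Fin h ⊕ Fin m) (Fin n) ℤ)
    (hA : ∀ j, (∀ i, A (Sum.inl i) j = W i j) ∧ (∀ i, A (Sum.inr i) j = M i j))
    (g : Fin n → ℤ) (hg : IsGraverElement A g) :
    ∃ (ℓ : ℕ) (gs : Fin ℓ → Fin n → ℤ),
      (ℓ : ℤ) ≤ (2 * (Δ : ℤ) * (h : ℤ) * (2 * (m : ℤ) + 1) + 1) ^ h ∧
      (∀ j, (∑ k, gs k j) = g j) ∧
      ∀ k, gs k ≠ 0 ∧ M.mulVec (gs k) = 0 ∧
        (∀ j, |gs k j| ≤ |g j| ∧ 0 ≤ gs k j * g j) ∧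
        (∑ j, |gs k j|) ≤ 2 * (m : ℤ) + 1 ∧
        (∀ j, |gs k j| ≤ 2) := by
  classical
  obtain ⟨hg0, hgk, hgm⟩ := hg
  have hAW : ∀ (y : Fin n → ℤ) i, A.mulVec y (Sum.inl i) = ∑ j, W i j * y j := by
    intro y i; simp [Matrix.mulVec, dotProduct, (hA _).1]
  have hAM : ∀ (y : Fin n → ℤ) i, A.mulVec y (Sum.inr i) = ∑ j, M i j * y j := by
    intro y i; simp [Matrix.mulVec, dotProduct, (hA _).2]
  let σ : Fin n → ℤ := fun j => if 0 ≤ g j then 1 else -1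
  have hσ : ∀ j, σ j = 1 ∨ σ j = -1 := by
    intro j; simp only [σ]; split_ifs <;> simp
  have hσabs : ∀ j, |σ j| = 1 := by
    intro j; rcases hσ j with h | h <;> simp [h]
  have hσg : ∀ j, σ j * |g j| = g j := by
    intro j
    simp only [σ]
    split_ifs with h
    · rw [abs_of_nonneg h, one_mul]
    · rw [abs_of_neg (not_le.1 h)]; ring
  let c : Fin n → Fin m → ℤ := fun j i => M i j * σ j
  have hc : ∀ j, ∑ i, |c j i| ≤ 2 := by
    intro j
    simp only [c, abs_mul, hσabs, mul_one]
    exact hM j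
  have hlc : ∀ (y : Fin n → ℤ) i, lcomb c y i = ∑ j, M i j * (σ j * y j) := by
    intro y i
    simp only [lcomb, c]
    exact Finset.sum_congr rfl (fun j _ => by ring)
  have hker : lcomb c (fun j => |g j|) = 0 := by
    funext i
    rw [hlc]
    simp only [hσg]
    rw [← hAM, hgk]; rfl
  obtain ⟨ℓ, ys, hys, hyp⟩ := decomp c (∑ j, |g j|).toNat (fun j => |g j|) (fun j => abs_nonneg _)
    (Int.self_le_toNat _) hker
  have hysj : ∀ j, ∑ k, ys k j = |g j| := by
    intro j
    have := congrFun hys j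
    simpa [Finset.sum_apply] using this
  have hbd : ∀ k, ∑ j, ys k j ≤ 2 * (m : ℤ) + 1 ∧ ∀ j, ys k j ≤ 2 := fun k =>
    graver_bound c hc (ys k) (hyp k).1 (hyp k).2.1 (hyp k).2.2.1 (hyp k).2.2.2
  have habs : ∀ k j, |σ j * ys k j| = ys k j := by
    intro k j
    rw [abs_mul, hσabs, one_mul, abs_of_nonneg ((hyp k).1 j)]
  have hσpos : ∀ j, 0 ≤ σ j * g j := by
    intro j
    simp only [σ]
    split_ifs with h
    · simpa using h
    · simp only [not_le] at h; linarith
  have hsubsum : ∀ (S : Finset (Fin ℓ)) j, 0 ≤ ∑ k ∈ S, ys k j ∧ ∑ k ∈ S, ys k j ≤ |g j| := by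
    intro S j
    refine ⟨Finset.sum_nonneg (fun k _ => (hyp k).1 j), ?_⟩
    rw [← hysj j]
    exact Finset.sum_le_sum_of_subset_of_nonneg (Finset.subset_univ _) (fun k _ _ => (hyp k).1 j)
  refine ⟨ℓ, fun k j => σ j * ys k j, ?_, ?_, ?_⟩
  · let w : Fin ℓ → Fin h → ℤ := fun k i => ∑ j, W i j * (σ j * ys k j)
    have hwS : ∀ (S : Finset (Fin ℓ)) i, ∑ k ∈ S, w k i = ∑ j, W i j * (σ j * ∑ k ∈ S, ys k j) := by
      intro S i
      simp only [w]
      rw [Finset.sum_comm]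
      simp only [Finset.mul_sum]
    have hcount := steinitz_count w (Δ * (2 * (m : ℤ) + 1)) (by positivity) ?_ ?_ ?_
    · calc (ℓ : ℤ) ≤ _ := hcount
        _ = _ := by congr 1; ring
    · intro k i
      calc |w k i| ≤ ∑ j, |W i j * (σ j * ys k j)| := Finset.abs_sum_le_sum_abs _ _
        _ ≤ ∑ j, (Δ : ℤ) * ys k j := by
          apply Finset.sum_le_sum
          intro j _
          rw [abs_mul, habs]
          exact mul_le_mul_of_nonneg_right (hW i j) ((hyp k).1 j)
        _ = Δ * ∑ j, ys k j := by rw [Finset.mul_sum]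
        _ ≤ _ := mul_le_mul_of_nonneg_left (hbd k).1 (by positivity)
    · intro i
      rw [hwS]
      simp only [hysj, hσg]
      rw [← hAW, hgk]; rfl
    · intro S hSne hSu
      by_contra hcon
      push Not at hcon
      have hpos : ∀ k, ∃ j, 0 < ys k j := by
        intro k
        by_contra hh
        push Not at hh
        exact (hyp k).2.1 (funext fun j => le_antisymm (hh j) ((hyp k).1 j))
      apply hgm (fun j => σ j * ∑ k ∈ S, ys k j)
      · intro h0
        obtain ⟨k, hk⟩ := hSne
        obtain ⟨j, hj⟩ := hpos k
        have h1 : ys k j ≤ ∑ k ∈ S, ys k j :=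
          Finset.single_le_sum (f := fun k => ys k j) (fun k _ => (hyp k).1 j) hk
        have h2 := congrFun h0 j
        simp only [Pi.zero_apply] at h2
        rcases hσ j with h | h <;> rw [h] at h2 <;> linarith
      · intro heq
        obtain ⟨k, hk⟩ : ∃ k, k ∉ S := by
          by_contra hh
          push Not at hh
          exact hSu (Finset.eq_univ_iff_forall.2 hh)
        obtain ⟨j, hj⟩ := hpos k
        have h1 : ∑ k ∈ insert k S, ys k j ≤ |g j| := (hsubsum _ j).2
        rw [Finset.sum_insert hk] at h1
        have h2 : σ j * ∑ k ∈ S, ys k j = σ j * |g j| := (congrFun heq j).trans (hσg j).symm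
        rcases hσ j with h | h <;> rw [h] at h2 <;> linarith
      · funext i
        rcases i with i | i
        · rw [hAW, ← hwS, hcon]; rfl
        · rw [hAM]
          have h1 : ∀ j, M i j * (σ j * ∑ k ∈ S, ys k j) = ∑ k ∈ S, M i j * (σ j * ys k j) := by
            intro j; simp only [Finset.mul_sum]
          simp only [h1]
          rw [Finset.sum_comm]
          apply Finset.sum_eq_zero
          intro k _
          rw [← hlc, (hyp k).2.2.1]; rfl
      · intro j
        have h1 := hsubsum S j
        constructor
        · rw [abs_mul, hσabs, one_mul, abs_of_nonneg h1.1]; exact h1.2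
        · have := mul_nonneg (hσpos j) h1.1
          linarith
  · intro j
    rw [← Finset.mul_sum, hysj, hσg]
  · intro k
    refine ⟨?_, ?_, ?_, ?_, ?_⟩
    · intro h0
      apply (hyp k).2.1
      funext j
      have h2 : σ j * ys k j = 0 := congrFun h0 j
      have h3 := habs k j
      rw [h2] at h3
      simpa using h3.symm
    · funext i
      have h1 := congrFun (hyp k).2.2.1 i
      rw [hlc] at h1
      simpa [Matrix.mulVec, dotProduct] using h1
    · intro j
      simp only [habs]
      have h1 := hsubsum {k} j
      simp only [Finset.sum_singleton] at h1
      refine ⟨h1.2, ?_⟩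
      have := mul_nonneg (hσpos j) h1.1
      linarith
    · simp only [habs]; exact (hbd k).1
    · intro j
      simp only [habs]; exact (hbd k).2 j
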